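/- Let Q be an integral matrix whose columns are indexed by a finite set S, let p be an integral vector, and suppose the linear system Qx ≥ p is box-TDI, defining R := {x : Qx ≥ p} ⊆ ℝ^S. Let z* be an integral element of R, and let ℓ : S → ℤ ∪ {−∞} and u : S → ℤ ∪ {+∞} be bounding vectors with ℓ ≤ u. Then there exists an integer-valued vector y* ≥ 0 with ℓ ≤ y*Q ≤ u and y*(Qz* − p) = 0 if and only if ℓ̃(S⁻) ≤ ũ(S⁺) holds (in the extended integers) for every pair (S⁻, S⁺) of disjoint subsets of S for which z* + χ_{S⁺} − χ_{S⁻} ∈ R, where χ_X denotes the characteristic vector of X ⊆ S and ℓ̃(X) := Σ_{s∈X} ℓ(s), ũ(X) := Σ_{s∈X} u(s). -/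

import Mathlib

open Matrix

/-- A rational linear system `A x ≥ b` is totally dual integral (TDI): for every integral
cost vector `c` for which the dual program `max {y b : y ≥ 0, y A = c}` is feasible and
bounded, the maximum is attained by an integral vector `y`. -/
def IsTDI {ι κ : Type} [Fintype ι] [Fintype κ] (A : Matrix ι κ ℚ) (b : ι → ℚ) : Prop :=
  ∀ c : κ → ℤ,
    (∃ y : ι → ℚ, 0 ≤ y ∧ y ᵥ* A = fun j => (c j : ℚ)) →
    (∃ M : ℚ, ∀ y : ι → ℚ, 0 ≤ y → (y ᵥ* A = fun j => (c j : ℚ)) → y ⬝ᵥ b ≤ M) →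
    ∃ y : ι → ℚ, (∀ i, ∃ z : ℤ, y i = z) ∧ 0 ≤ y ∧ (y ᵥ* A = fun j => (c j : ℚ)) ∧
      ∀ y' : ι → ℚ, 0 ≤ y' → (y' ᵥ* A = fun j => (c j : ℚ)) → y' ⬝ᵥ b ≤ y ⬝ᵥ b

/-- The coefficient matrix of the system `[A x ≥ b, x ≥ f, -x ≥ -g]`. -/
def boxMatrix {ι κ : Type} [DecidableEq κ] (A : Matrix ι κ ℚ) : Matrix (ι ⊕ (κ ⊕ κ)) κ ℚ :=
  Matrix.of fun i j =>
    match i with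
    | Sum.inl i => A i j
    | Sum.inr (Sum.inl i) => if i = j then 1 else 0
    | Sum.inr (Sum.inr i) => if i = j then -1 else 0

/-- The right-hand side of the system `[A x ≥ b, x ≥ f, -x ≥ -g]`. -/
def boxRHS {ι κ : Type} (b : ι → ℚ) (f g : κ → ℚ) : ι ⊕ (κ ⊕ κ) → ℚ :=
  Sum.elim b (Sum.elim f fun j => -(g j))

/-- A rational linear system `A x ≥ b` is box-TDI: for all rational finite-valued
bounding vectors `f ≤ g`, the system `[A x ≥ b, f ≤ x ≤ g]` is TDI. -/
def IsBoxTDI {ι κ : Type} [Fintype ι] [Fintype κ] [DecidableEq κ]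
    (A : Matrix ι κ ℚ) (b : ι → ℚ) : Prop :=
  ∀ f g : κ → ℚ, f ≤ g → IsTDI (boxMatrix A) (boxRHS b f g)

/-- **Farkas' lemma** over an ordered field, in its homogeneous form. -/
theorem exists_nonneg_linear_combination {V ι : Type*} [AddCommGroup V] [Module ℚ V]
    (t : Finset ι) (a : ι → V →ₗ[ℚ] ℚ) (b : V →ₗ[ℚ] ℚ)
    (h : ∀ x, (∀ i ∈ t, 0 ≤ a i x) → 0 ≤ b x) :
    ∃ w : ι → ℚ, 0 ≤ w ∧ ∀ x, b x = ∑ i ∈ t, w i * a i x := by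
  classical
  induction t using Finset.induction_on generalizing a b with
  | empty =>
    refine ⟨0, le_rfl, fun x => ?_⟩
    have h1 := h x (by simp)
    have h2 := h (-x) (by simp)
    rw [map_neg] at h2
    simp only [Finset.sum_empty]
    linarith
  | insert j t hj ih =>
    by_cases hb : ∀ x, (∀ i ∈ t, 0 ≤ a i x) → 0 ≤ b x
    · obtain ⟨w, hw, hwb⟩ := ih a b hb
      refine ⟨Function.update w j 0, fun i => ?_, fun x => ?_⟩
      · by_cases hi : i = j
        · subst hi; simp
        · simpa [hi] using hw i
      · rw [Finset.sum_insert hj, hwb x]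
        simp only [Function.update_self, zero_mul, zero_add]
        refine Finset.sum_congr rfl fun i hi => ?_
        rw [Function.update_of_ne (by rintro rfl; exact hj hi)]
    · push Not at hb
      obtain ⟨x₀, hx₀, hbx₀⟩ := hb
      have haj : a j x₀ < 0 := by
        by_contra! hc
        exact absurd (h x₀ (by simpa [hc] using hx₀)) (not_le.2 hbx₀)
      set k : ℚ := -(a j x₀)⁻¹ with hk
      have hk0 : 0 < k := by rw [hk]; exact neg_pos.2 (inv_lt_zero.2 haj)
      have hka : k * a j x₀ = -1 := by rw [hk, neg_mul, inv_mul_cancel₀ haj.ne]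
      obtain ⟨w, hw, hwb⟩ := ih (fun i => a i + (k * a i x₀) • a j) (b + (k * b x₀) • a j) (by
        intro x hx
        have := h (x + (k * a j x) • x₀) (by
          intro i hi
          rcases Finset.mem_insert.1 hi with rfl | hi
          · simp only [map_add, map_smul, smul_eq_mul]
            have : k * a i x * a i x₀ = -a i x := by linear_combination a i x * hka
            linarith
          · have := hx i hi
            simp only [LinearMap.add_apply, LinearMap.smul_apply, smul_eq_mul] at this
            simp only [map_add, map_smul, smul_eq_mul]
            linarith)
        simp only [map_add, map_smul, smul_eq_mul] at this
        simp only [LinearMap.add_apply, LinearMap.smul_apply, smul_eq_mul]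
        linarith)
      have hsum : 0 ≤ ∑ i ∈ t, w i * a i x₀ :=
        Finset.sum_nonneg fun i hi => mul_nonneg (hw i) (hx₀ i hi)
      refine ⟨Function.update w j (k * (∑ i ∈ t, w i * a i x₀ - b x₀)), fun i => ?_, fun x => ?_⟩
      · by_cases hi : i = j
        · subst hi
          simpa using mul_nonneg hk0.le (by linarith)
        · simpa [hi] using hw i
      · rw [Finset.sum_insert hj, Function.update_self]
        have e : ∑ i ∈ t, Function.update w j (k * (∑ i ∈ t, w i * a i x₀ - b x₀)) i * a i x
            = ∑ i ∈ t, w i * a i x := by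
          refine Finset.sum_congr rfl fun i hi => ?_
          rw [Function.update_of_ne (by rintro rfl; exact hj hi)]
        have h1 := hwb x
        simp only [LinearMap.add_apply, LinearMap.smul_apply, smul_eq_mul, mul_add,
          Finset.sum_add_distrib] at h1
        have e2 : ∑ i ∈ t, w i * (k * a i x₀ * a j x) = k * a j x * ∑ i ∈ t, w i * a i x₀ := by
          rw [Finset.mul_sum]
          exact Finset.sum_congr rfl fun i _ => by ring
        rw [e]
        linear_combination h1 + e2

/-- **Farkas' lemma** for an inhomogeneous system of linear inequalities. -/
theorem exists_infeasibility_certificate {ι κ : Type*} [Fintype ι] [Fintype κ]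
    (A : Matrix ι κ ℚ) (b : ι → ℚ) (h : ¬ ∃ x, b ≤ A *ᵥ x) :
    ∃ y : ι → ℚ, 0 ≤ y ∧ y ᵥ* A = 0 ∧ 0 < y ⬝ᵥ b := by
  classical
  obtain ⟨w, hw, hwe⟩ := exists_nonneg_linear_combination (V := (κ → ℚ) × ℚ)
    (Finset.univ : Finset (Option ι))
    (fun o => o.elim (LinearMap.snd ℚ (κ → ℚ) ℚ) fun i =>
      (LinearMap.proj i ∘ₗ A.mulVecLin) ∘ₗ LinearMap.fst ℚ (κ → ℚ) ℚ
        - b i • LinearMap.snd ℚ (κ → ℚ) ℚ)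
    (-LinearMap.snd ℚ (κ → ℚ) ℚ) (by
      rintro ⟨x, r⟩ hx
      simp only [LinearMap.neg_apply, LinearMap.snd_apply]
      by_contra! hr
      have hr : 0 < r := by linarith
      refine h ⟨r⁻¹ • x, fun i => ?_⟩
      have := hx (some i) (Finset.mem_univ _)
      simp only [Option.elim, LinearMap.sub_apply, LinearMap.comp_apply, LinearMap.fst_apply,
        LinearMap.smul_apply, LinearMap.snd_apply, smul_eq_mul, LinearMap.proj_apply,
        Matrix.mulVecLin_apply] at this
      rw [Matrix.mulVec_smul, Pi.smul_apply, smul_eq_mul, inv_mul_eq_div, le_div_iff₀ hr]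
      linarith)
  have key : ∀ x r, -r = w none * r + ∑ i, w (some i) * ((A *ᵥ x) i - b i * r) := by
    intro x r
    simpa [Fintype.sum_option] using hwe (x, r)
  refine ⟨fun i => w (some i), fun i => hw _, ?_, ?_⟩
  · funext j
    have := key (Pi.single j 1) 0
    simpa [Matrix.vecMul, dotProduct] using this.symm
  · have := key 0 1
    have h0 := hw none
    simp only [Pi.zero_apply] at h0
    simp only [Matrix.mulVec_zero, Pi.zero_apply, zero_sub, mul_one, mul_neg,
      Finset.sum_neg_distrib] at this
    simp only [dotProduct]
    linarith

theorem dotProduct_le_of_dual_feasible {ι κ : Type*} [Fintype ι] [Fintype κ]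
    {A : Matrix ι κ ℚ} {b : ι → ℚ} {c : κ → ℚ} {x : κ → ℚ} {y : ι → ℚ}
    (hx : b ≤ A *ᵥ x) (hy : 0 ≤ y) (hyc : y ᵥ* A = c) : y ⬝ᵥ b ≤ c ⬝ᵥ x := by
  rw [← hyc, ← Matrix.dotProduct_mulVec]
  exact dotProduct_le_dotProduct_of_nonneg_left hx hy

/-- A TDI system with integral right-hand side has integral and attained optimal values. -/
theorem IsTDI.exists_int_min {ι κ : Type} [Fintype ι] [Fintype κ]
    {A : Matrix ι κ ℚ} {b : ι → ℚ} (h : IsTDI A b) (hb : ∀ i, ∃ k : ℤ, b i = k) (c : κ → ℤ)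
    (hc : ∃ y : ι → ℚ, 0 ≤ y ∧ y ᵥ* A = fun j => (c j : ℚ)) (hP : ∃ x, b ≤ A *ᵥ x) :
    ∃ M : ℤ, (∃ x, b ≤ A *ᵥ x ∧ (fun j => (c j : ℚ)) ⬝ᵥ x = M) ∧
      ∀ x, b ≤ A *ᵥ x → M ≤ (fun j => (c j : ℚ)) ⬝ᵥ x := by
  obtain ⟨x₀, hx₀⟩ := hP
  obtain ⟨y, hyint, hy, hyc, hymax⟩ := h c hc
    ⟨_, fun y hy hyc => dotProduct_le_of_dual_feasible hx₀ hy hyc⟩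
  choose yz hyz using hyint
  choose bz hbz using hb
  have hM : y ⬝ᵥ b = ((∑ i, yz i * bz i : ℤ) : ℚ) := by simp [dotProduct, hyz, hbz]
  refine ⟨∑ i, yz i * bz i, ?_, fun x hx => hM ▸ dotProduct_le_of_dual_feasible hx hy hyc⟩
  rw [← hM]
  suffices hx : ∃ x, b ≤ A *ᵥ x ∧ (fun j => (c j : ℚ)) ⬝ᵥ x ≤ y ⬝ᵥ b by
    obtain ⟨x, hx, hxc⟩ := hx
    exact ⟨x, hx, hxc.antisymm (dotProduct_le_of_dual_feasible hx hy hyc)⟩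
  by_contra hno
  obtain ⟨v, hv, hvA, hvb⟩ := exists_infeasibility_certificate
    (Matrix.fromRows A (Matrix.of fun (_ : Unit) j => -(c j : ℚ)))
    (Sum.elim b fun _ => -(y ⬝ᵥ b)) (by
      rintro ⟨x, hx⟩
      refine hno ⟨x, fun i => ?_, ?_⟩
      · simpa [Matrix.fromRows_mulVec] using hx (Sum.inl i)
      · have := hx (Sum.inr ())
        simp [Matrix.mulVec, dotProduct] at this
        simpa [dotProduct] using this)
  set r := v (Sum.inr ()) with hr
  set v' : ι → ℚ := fun i => v (Sum.inl i) with hv'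
  have hv'0 : 0 ≤ v' := fun i => hv _
  have hr0 : 0 ≤ r := hv _
  have hvA' : v' ᵥ* A = r • fun j => (c j : ℚ) := by
    funext j
    have := congrFun hvA j
    simp [Matrix.vecMul, dotProduct, Fintype.sum_sum_type] at this
    simp [Matrix.vecMul, dotProduct, hr, hv']
    linarith
  have hvb' : r * (y ⬝ᵥ b) < v' ⬝ᵥ b := by
    simp only [dotProduct, Fintype.sum_sum_type, Sum.elim_inl, Sum.elim_inr,
      Finset.univ_unique, Finset.sum_singleton] at hvb
    simp only [dotProduct, hr, hv']
    have : (default : Unit) = () := rfl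
    rw [this] at hvb
    linarith
  rcases hr0.eq_or_lt with h0 | h0
  · have := dotProduct_le_of_dual_feasible hx₀ hv'0 hvA'
    rw [← h0] at this hvb'
    simp at this hvb'
    linarith
  · have := hymax (r⁻¹ • v') (smul_nonneg (inv_nonneg.2 hr0) hv'0) (by
      rw [Matrix.smul_vecMul, hvA', smul_smul, inv_mul_cancel₀ h0.ne', one_smul])
    rw [smul_dotProduct, smul_eq_mul, inv_mul_le_iff₀ h0] at this
    linarith

section Box

variable {ι κ : Type} [DecidableEq κ]

theorem boxRHS_le_boxMatrix_mulVec [Fintype κ] {A : Matrix ι κ ℚ} {b : ι → ℚ} {f g x : κ → ℚ} :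
    boxRHS b f g ≤ boxMatrix A *ᵥ x ↔ b ≤ A *ᵥ x ∧ f ≤ x ∧ x ≤ g := by
  simp [Pi.le_def, boxRHS, boxMatrix, Matrix.mulVec, dotProduct]

theorem boxMatrix_mulVec_sub_boxRHS [Fintype κ] (A : Matrix ι κ ℚ) (b : ι → ℚ) (f g x : κ → ℚ) :
    boxMatrix A *ᵥ x - boxRHS b f g = Sum.elim (A *ᵥ x - b) (Sum.elim (x - f) (g - x)) := by
  funext i
  rcases i with i | s | s
  · simp [boxRHS, boxMatrix, Matrix.mulVec, dotProduct]
  · simp [boxRHS, boxMatrix, Matrix.mulVec, dotProduct]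
  · simp [boxRHS, boxMatrix, Matrix.mulVec, dotProduct]
    ring

theorem vecMul_boxMatrix [Fintype ι] [Fintype κ] (A : Matrix ι κ ℚ) (y : ι ⊕ (κ ⊕ κ) → ℚ) (s : κ) :
    (y ᵥ* boxMatrix A) s =
      ((fun i => y (Sum.inl i)) ᵥ* A) s + y (Sum.inr (Sum.inl s)) - y (Sum.inr (Sum.inr s)) := by
  simp [boxMatrix, Matrix.vecMul, dotProduct, Fintype.sum_sum_type]
  ring

variable [Fintype ι] [Fintype κ] {A : Matrix ι κ ℚ} {b : ι → ℚ}

theorem IsBoxTDI.exists_int_min (h : IsBoxTDI A b) (hb : ∀ i, ∃ k : ℤ, b i = k) {f g : κ → ℚ}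
    (hf : ∀ s, ∃ k : ℤ, f s = k) (hg : ∀ s, ∃ k : ℤ, g s = k) (c : κ → ℤ)
    (hP : ∃ x, b ≤ A *ᵥ x ∧ f ≤ x ∧ x ≤ g) :
    ∃ M : ℤ, (∃ x, (b ≤ A *ᵥ x ∧ f ≤ x ∧ x ≤ g) ∧ (fun j => (c j : ℚ)) ⬝ᵥ x = M) ∧
      ∀ x, b ≤ A *ᵥ x ∧ f ≤ x ∧ x ≤ g → M ≤ (fun j => (c j : ℚ)) ⬝ᵥ x := by
  have hfg : f ≤ g := by
    obtain ⟨x, -, h1, h2⟩ := hP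
    exact h1.trans h2
  simp only [← boxRHS_le_boxMatrix_mulVec] at hP ⊢
  refine (h f g hfg).exists_int_min ?_ c ?_ hP
  · rintro (i | s | s)
    · exact hb i
    · exact hf s
    · obtain ⟨k, hk⟩ := hg s
      exact ⟨-k, by simp [boxRHS, hk]⟩
  · refine ⟨Sum.elim 0 (Sum.elim (fun s => max (c s : ℚ) 0) fun s => max (-(c s : ℚ)) 0), ?_, ?_⟩
    · rintro (i | s | s) <;> simp
    · funext s
      rw [vecMul_boxMatrix]
      have : (fun i => Sum.elim (0 : ι → ℚ) (Sum.elim (fun s => max (c s : ℚ) 0)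
        fun s => max (-(c s : ℚ)) 0) (Sum.inl i)) = 0 := rfl
      rw [this]
      simp only [Matrix.zero_vecMul, Pi.zero_apply, Sum.elim_inr, Sum.elim_inl]
      rcases le_total (c s : ℚ) 0 with h0 | h0
      · rw [max_eq_right h0, max_eq_left (by linarith)]; ring
      · rw [max_eq_left h0, max_eq_right (by linarith)]; ring

theorem exists_eq_succ_of_le_succ {v : ℕ → ℤ} {B : ℤ} (hv : ∀ n, v n ≤ v (n + 1))
    (hB : ∀ n, v n ≤ B) : ∃ n, v n = v (n + 1) := by
  by_contra! hne
  have hgrow : ∀ n : ℕ, v 0 + n ≤ v n := by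
    intro n
    induction n with
    | zero => simp
    | succ n ih =>
      have := lt_of_le_of_ne (hv n) (hne n)
      push_cast
      linarith
  have h1 := hgrow (B - v 0 + 1).toNat
  have h2 := hB (B - v 0 + 1).toNat
  have h3 := Int.self_le_toNat (B - v 0 + 1)
  linarith

/-- Some optimal solution of a box-constrained problem is integral at a prescribed coordinate. -/
theorem IsBoxTDI.exists_min_int_coord (h : IsBoxTDI A b) (hb : ∀ i, ∃ k : ℤ, b i = k)
    {f g : κ → ℚ} (hf : ∀ s, ∃ k : ℤ, f s = k) (hg : ∀ s, ∃ k : ℤ, g s = k) (c : κ → ℤ) (M : ℤ)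
    (hM : ∃ x, (b ≤ A *ᵥ x ∧ f ≤ x ∧ x ≤ g) ∧ (fun j => (c j : ℚ)) ⬝ᵥ x = M)
    (hmin : ∀ x, b ≤ A *ᵥ x ∧ f ≤ x ∧ x ≤ g → M ≤ (fun j => (c j : ℚ)) ⬝ᵥ x) (s : κ) :
    ∃ x, (b ≤ A *ᵥ x ∧ f ≤ x ∧ x ≤ g) ∧ (fun j => (c j : ℚ)) ⬝ᵥ x = M ∧ ∃ k : ℤ, x s = k := by
  obtain ⟨x₀, hx₀, hx₀M⟩ := hM
  have hdot : ∀ (n : ℕ) (x : κ → ℚ), (fun j => ((n * c j + if j = s then 1 else 0 : ℤ) : ℚ)) ⬝ᵥ x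
      = n * ((fun j => (c j : ℚ)) ⬝ᵥ x) + x s := by
    intro n x
    simp [dotProduct, add_mul, Finset.sum_add_distrib, Finset.mul_sum, mul_assoc]
  choose N hN hNmin using fun n : ℕ => h.exists_int_min hb hf hg
    (fun j => n * c j + if j = s then 1 else 0) ⟨x₀, hx₀⟩
  choose X hX hXN using hN
  simp only [hdot] at hXN hNmin
  obtain ⟨G, hG⟩ := hg s
  obtain ⟨n, hn⟩ := exists_eq_succ_of_le_succ (v := fun n => N n - n * M) (B := G) (by
      intro n
      have h1 := hNmin n _ (hX (n + 1))
      have h2 := hXN (n + 1)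
      have h3 := hmin _ (hX (n + 1))
      have : ((N n - n * M : ℤ) : ℚ) ≤ ((N (n + 1) - (n + 1 : ℕ) * M : ℤ) : ℚ) := by
        push_cast at *
        linarith
      exact_mod_cast this) (by
      intro n
      have h1 := hNmin n _ hx₀
      have h2 := hx₀.2.2 s
      have : ((N n - n * M : ℤ) : ℚ) ≤ (G : ℚ) := by
        push_cast
        rw [hx₀M] at h1
        linarith
      exact_mod_cast this)
  have hn' : ((N n - n * M : ℤ) : ℚ) = ((N (n + 1) - (n + 1 : ℕ) * M : ℤ) : ℚ) := by
    exact_mod_cast hn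
  have h1 := hNmin n _ (hX (n + 1))
  have h2 := hXN (n + 1)
  have h3 := hmin _ (hX (n + 1))
  push_cast at hn' h2
  have hXM : (fun j => (c j : ℚ)) ⬝ᵥ X (n + 1) = M := by linarith
  refine ⟨X (n + 1), hX _, hXM, N (n + 1) - (n + 1 : ℕ) * M, ?_⟩
  rw [hXM] at h2
  push_cast
  linarith

/-- Minimizing over a box-TDI system intersected with an integral box, the optimum is attained
by an integral vector; hence any feasible point can be replaced by an integral one. -/
theorem IsBoxTDI.exists_int_dotProduct_le (h : IsBoxTDI A b) (hb : ∀ i, ∃ k : ℤ, b i = k)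
    {f g : κ → ℚ} (hf : ∀ s, ∃ k : ℤ, f s = k) (hg : ∀ s, ∃ k : ℤ, g s = k) (c : κ → ℤ)
    {x₀ : κ → ℚ} (hx₀ : b ≤ A *ᵥ x₀ ∧ f ≤ x₀ ∧ x₀ ≤ g) :
    ∃ x : κ → ℚ, (b ≤ A *ᵥ x ∧ f ≤ x ∧ x ≤ g) ∧ (∀ s, ∃ k : ℤ, x s = k) ∧
      (fun j => (c j : ℚ)) ⬝ᵥ x ≤ (fun j => (c j : ℚ)) ⬝ᵥ x₀ := by
  obtain ⟨M, hM, hmin⟩ := h.exists_int_min hb hf hg c ⟨x₀, hx₀⟩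
  suffices H : ∀ T : Finset κ, ∃ x, (b ≤ A *ᵥ x ∧ f ≤ x ∧ x ≤ g) ∧
      (fun j => (c j : ℚ)) ⬝ᵥ x = M ∧ ∀ s ∈ T, ∃ k : ℤ, x s = k by
    obtain ⟨x, hx, hxM, hxT⟩ := H Finset.univ
    exact ⟨x, hx, fun s => hxT s (Finset.mem_univ s), hxM ▸ hmin x₀ hx₀⟩
  intro T
  induction T using Finset.induction_on with
  | empty =>
    obtain ⟨x, hx, hxM⟩ := hM
    exact ⟨x, hx, hxM, by simp⟩
  | insert s T _ ih =>
    obtain ⟨x, hx, hxM, hxT⟩ := ih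
    have hle : (fun j => if j ∈ T then x j else f j) ≤ x ∧ x ≤ fun j => if j ∈ T then x j else g j :=
      ⟨fun j => by dsimp only; split_ifs; exacts [le_rfl, hx.2.1 j],
        fun j => by dsimp only; split_ifs; exacts [le_rfl, hx.2.2 j]⟩
    have hsub : ∀ x' : κ → ℚ, (fun j => if j ∈ T then x j else f j) ≤ x' →
        (x' ≤ fun j => if j ∈ T then x j else g j) →
        (f ≤ x' ∧ x' ≤ g) ∧ ∀ j ∈ T, x' j = x j := by
      intro x' h1 h2
      refine ⟨⟨fun j => ?_, fun j => ?_⟩, fun j hj => ?_⟩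
      · have := h1 j
        dsimp only at this
        split_ifs at this
        exacts [(hx.2.1 j).trans this, this]
      · have := h2 j
        dsimp only at this
        split_ifs at this
        exacts [this.trans (hx.2.2 j), this]
      · have h1 := h1 j
        have h2 := h2 j
        simp only [hj, if_true] at h1 h2
        exact h2.antisymm h1
    obtain ⟨x', ⟨hx', h1, h2⟩, hx'M, hx's⟩ := h.exists_min_int_coord hb
      (f := fun j => if j ∈ T then x j else f j) (g := fun j => if j ∈ T then x j else g j)
      (fun j => by split_ifs with hj; exacts [hxT j hj, hf j])
      (fun j => by split_ifs with hj; exacts [hxT j hj, hg j]) c M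
      ⟨x, ⟨hx.1, hle⟩, hxM⟩ (fun x' hx' => hmin x' ⟨hx'.1, (hsub x' hx'.2.1 hx'.2.2).1⟩) s
    obtain ⟨hbox, hT⟩ := hsub x' h1 h2
    refine ⟨x', ⟨hx', hbox⟩, hx'M, fun j hj => ?_⟩
    rcases Finset.mem_insert.1 hj with rfl | hj
    · exact hx's
    · rw [hT j hj]
      exact hxT j hj

/-- If some nonnegative combination of the rows that are tight at `z` takes prescribed integral
values on `T`, then so does an integral one. -/
theorem IsBoxTDI.exists_int_tight_combination (h : IsBoxTDI A b) {z : κ → ℚ} (hz : b ≤ A *ᵥ z)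
    (T : Finset κ) (c : κ → ℤ) {y : ι → ℚ} (hy : 0 ≤ y) (hyz : y ⬝ᵥ (A *ᵥ z - b) = 0)
    (hyT : ∀ s ∈ T, (y ᵥ* A) s = c s) :
    ∃ y' : ι → ℚ, (∀ i, ∃ k : ℤ, y' i = k) ∧ 0 ≤ y' ∧ y' ⬝ᵥ (A *ᵥ z - b) = 0 ∧
      ∀ s ∈ T, (y' ᵥ* A) s = c s := by
  set δ : κ → ℚ := fun s => if s ∈ T then 1 else 0 with hδ
  have hδ0 : 0 ≤ δ := fun s => by simp only [hδ]; split_ifs <;> simp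
  have hgap : ∀ Y : ι ⊕ (κ ⊕ κ) → ℚ, (Y ᵥ* boxMatrix A = fun j => (c j : ℚ)) →
      (fun j => (c j : ℚ)) ⬝ᵥ z - Y ⬝ᵥ boxRHS b (z - δ) (z + δ) =
        (fun i => Y (Sum.inl i)) ⬝ᵥ (A *ᵥ z - b) +
          ((fun s => Y (Sum.inr (Sum.inl s))) ⬝ᵥ δ + (fun s => Y (Sum.inr (Sum.inr s))) ⬝ᵥ δ) := by
    intro Y hY
    rw [← hY, ← Matrix.dotProduct_mulVec, ← dotProduct_sub, boxMatrix_mulVec_sub_boxRHS]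
    simp [dotProduct, Fintype.sum_sum_type]
  have hzbox : boxRHS b (z - δ) (z + δ) ≤ boxMatrix A *ᵥ z :=
    boxRHS_le_boxMatrix_mulVec.2 ⟨hz, by simpa using hδ0, by simpa using hδ0⟩
  set Y₀ : ι ⊕ (κ ⊕ κ) → ℚ := Sum.elim y (Sum.elim
    (fun s => if s ∈ T then 0 else max ((c s : ℚ) - (y ᵥ* A) s) 0)
    (fun s => if s ∈ T then 0 else max (-((c s : ℚ) - (y ᵥ* A) s)) 0)) with hY₀
  have hY₀0 : 0 ≤ Y₀ := by
    rintro (i | s | s)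
    · exact hy i
    · simp only [hY₀, Sum.elim_inr, Sum.elim_inl]; split_ifs <;> simp
    · simp only [hY₀, Sum.elim_inr]; split_ifs <;> simp
  have hY₀c : Y₀ ᵥ* boxMatrix A = fun j => (c j : ℚ) := by
    funext s
    rw [vecMul_boxMatrix]
    have : (fun i => Y₀ (Sum.inl i)) = y := rfl
    rw [this]
    simp only [hY₀, Sum.elim_inr, Sum.elim_inl]
    split_ifs with hs
    · simp [hyT s hs]
    · rcases le_total ((c s : ℚ) - (y ᵥ* A) s) 0 with h0 | h0
      · rw [max_eq_right h0, max_eq_left (by linarith)]; ring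
      · rw [max_eq_left h0, max_eq_right (by linarith)]; ring
  have hY₀δ : (fun s => Y₀ (Sum.inr (Sum.inl s))) ⬝ᵥ δ = 0 ∧
      (fun s => Y₀ (Sum.inr (Sum.inr s))) ⬝ᵥ δ = 0 := by
    constructor <;>
    · refine Finset.sum_eq_zero fun s _ => ?_
      simp only [hY₀, hδ, Sum.elim_inr, Sum.elim_inl]
      split_ifs <;> simp
  obtain ⟨Y, hYint, hY, hYc, hYmax⟩ := h (z - δ) (z + δ)
    ((sub_le_self z hδ0).trans (le_add_of_nonneg_right hδ0)) c ⟨Y₀, hY₀0, hY₀c⟩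
    ⟨_, fun Y hY hYc => dotProduct_le_of_dual_feasible hzbox hY hYc⟩
  have hgap₀ := hgap Y₀ hY₀c
  rw [hY₀δ.1, hY₀δ.2, show (fun i => Y₀ (Sum.inl i)) = y from rfl, hyz] at hgap₀
  have hgapY := hgap Y hYc
  have hle := hYmax Y₀ hY₀0 hY₀c
  have h1 : 0 ≤ (fun i => Y (Sum.inl i)) ⬝ᵥ (A *ᵥ z - b) :=
    dotProduct_nonneg_of_nonneg (fun i => hY _) (sub_nonneg.2 hz)
  have h2 : 0 ≤ (fun s => Y (Sum.inr (Sum.inl s))) ⬝ᵥ δ :=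
    dotProduct_nonneg_of_nonneg (fun i => hY _) hδ0
  have h3 : 0 ≤ (fun s => Y (Sum.inr (Sum.inr s))) ⬝ᵥ δ :=
    dotProduct_nonneg_of_nonneg (fun i => hY _) hδ0
  refine ⟨fun i => Y (Sum.inl i), fun i => hYint _, fun i => hY _, by linarith, fun s hs => ?_⟩
  have hvanish : ∀ v : κ → ℚ, 0 ≤ v → v ⬝ᵥ δ ≤ 0 → v s = 0 := by
    intro v hv hvδ
    have : v s * δ s ≤ v ⬝ᵥ δ :=
      Finset.single_le_sum (f := fun s => v s * δ s) (fun i _ => mul_nonneg (hv i) (hδ0 i))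
        (Finset.mem_univ s)
    simp only [hδ, hs, if_true, mul_one] at this
    exact le_antisymm (this.trans hvδ) (hv s)
  have e := congrFun hYc s
  rw [vecMul_boxMatrix, hvanish (fun s => Y (Sum.inr (Sum.inl s))) (fun i => hY _) (by linarith),
    hvanish (fun s => Y (Sum.inr (Sum.inr s))) (fun i => hY _) (by linarith)] at e
  linarith

end Box

/-- Moving from `w` towards the integral point `w'`, one can stop at the first moment where a new
coordinate becomes integral, without leaving an integral box around `w`. -/
theorem exists_int_crossing {κ : Type*} {s₀ : κ} {N : Finset κ} {lo hi : κ → ℤ} {w w' : κ → ℚ}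
    (hlo : ∀ s, lo s ≤ w s) (hhi : ∀ s, w s ≤ hi s)
    (hw' : ∀ s, ∃ k : ℤ, w' s = k) (hs₀ : s₀ ∈ N) (hN : ∀ s, s ∈ N ↔ ¬ ∃ k : ℤ, w s = k)
    (heq : ∀ s ∉ N, w' s = w s) :
    ∃ t : ℚ, 0 ≤ t ∧ t ≤ 1 ∧ (∀ s, lo s ≤ w s + t * (w' s - w s) ∧
      w s + t * (w' s - w s) ≤ hi s) ∧ ∃ s ∈ N, ∃ k : ℤ, w s + t * (w' s - w s) = k := by
  have hcross : ∀ s, ∃ (k : ℤ) (t : ℚ), s ∈ N → 0 ≤ t ∧ t ≤ 1 ∧ lo s ≤ k ∧ k ≤ hi s ∧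
      w s + t * (w' s - w s) = k := by
    intro s
    by_cases hs : s ∈ N
    · obtain ⟨k', hk'⟩ := hw' s
      rcases lt_trichotomy (w s) (w' s) with hlt | he | hlt
      · have h1 : w s ≤ ⌈w s⌉ := Int.le_ceil _
        have h2 : (⌈w s⌉ : ℚ) ≤ w' s := by
          rw [hk']; exact_mod_cast Int.ceil_le.2 (hk' ▸ hlt.le)
        have h3 : 0 < w' s - w s := by linarith
        refine ⟨⌈w s⌉, (⌈w s⌉ - w s) / (w' s - w s), fun _ => ⟨?_, ?_, ?_, ?_, ?_⟩⟩
        · exact div_nonneg (by linarith) h3.le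
        · rw [div_le_one h3]; linarith
        · have : (lo s : ℚ) ≤ (⌈w s⌉ : ℤ) := (hlo s).trans h1
          exact_mod_cast this
        · exact Int.ceil_le.2 (hhi s)
        · rw [div_mul_cancel₀ _ h3.ne']; ring
      · exact absurd ⟨k', he.trans hk'⟩ ((hN s).1 hs)
      · have h1 : (⌊w s⌋ : ℚ) ≤ w s := Int.floor_le _
        have h2 : w' s ≤ (⌊w s⌋ : ℚ) := by
          rw [hk']; exact_mod_cast Int.le_floor.2 (hk' ▸ hlt.le)
        have h3 : w' s - w s < 0 := by linarith
        refine ⟨⌊w s⌋, (⌊w s⌋ - w s) / (w' s - w s), fun _ => ⟨?_, ?_, ?_, ?_, ?_⟩⟩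
        · exact div_nonneg_of_nonpos (by linarith) h3.le
        · rw [div_le_one_of_neg h3]; linarith
        · exact Int.le_floor.2 (hlo s)
        · have : ((⌊w s⌋ : ℤ) : ℚ) ≤ hi s := h1.trans (hhi s)
          exact_mod_cast this
        · rw [div_mul_cancel₀ _ h3.ne]; ring
    · exact ⟨0, 0, fun h => absurd h hs⟩
  choose k t hkt using hcross
  obtain ⟨s₁, hs₁, hmin⟩ := N.exists_min_image t ⟨s₀, hs₀⟩
  obtain ⟨ht0, ht1, -, -, htk⟩ := hkt s₁ hs₁
  refine ⟨t s₁, ht0, ht1, fun s => ?_, s₁, hs₁, k s₁, htk⟩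
  by_cases hs : s ∈ N
  · obtain ⟨hs0, hs1, hlk, hkh, hsk⟩ := hkt s hs
    have hlk' : (lo s : ℚ) ≤ k s := by exact_mod_cast hlk
    have hkh' : (k s : ℚ) ≤ hi s := by exact_mod_cast hkh
    have hts := hmin s hs
    have hl := hlo s
    have hh := hhi s
    rcases le_total 0 (w' s - w s) with h0 | h0
    · have h1 := mul_le_mul_of_nonneg_right hts h0
      have h2 := mul_nonneg ht0 h0
      constructor <;> linarith
    · have h1 := mul_le_mul_of_nonpos_right hts h0
      have h2 := mul_nonpos_of_nonneg_of_nonpos ht0 h0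
      constructor <;> linarith
  · rw [heq s hs]
    simpa using ⟨hlo s, hhi s⟩

/-- A nonnegative combination of the rows tight at `z` lying in an integral box can be replaced by
an integral one lying in the same box. -/
theorem IsBoxTDI.exists_int_tight_combination_mem_box {ι κ : Type} [Fintype ι] [Fintype κ]
    [DecidableEq κ] {Q : Matrix ι κ ℤ} {b : ι → ℚ}
    (h : IsBoxTDI (Q.map (Int.cast : ℤ → ℚ)) b) {z : κ → ℚ}
    (hz : b ≤ Q.map (Int.cast : ℤ → ℚ) *ᵥ z) (lo hi : κ → ℤ) {y : ι → ℚ} (hy : 0 ≤ y)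
    (hyz : y ⬝ᵥ (Q.map (Int.cast : ℤ → ℚ) *ᵥ z - b) = 0)
    (hlo : ∀ s, lo s ≤ (y ᵥ* Q.map (Int.cast : ℤ → ℚ)) s)
    (hhi : ∀ s, (y ᵥ* Q.map (Int.cast : ℤ → ℚ)) s ≤ hi s) :
    ∃ y' : ι → ℤ, 0 ≤ y' ∧
      (fun i => (y' i : ℚ)) ⬝ᵥ (Q.map (Int.cast : ℤ → ℚ) *ᵥ z - b) = 0 ∧
      ∀ s, lo s ≤ (y' ᵥ* Q) s ∧ (y' ᵥ* Q) s ≤ hi s := by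
  classical
  set A := Q.map (Int.cast : ℤ → ℚ) with hA
  induction hn : (Finset.univ.filter fun s => ¬ ∃ k : ℤ, (y ᵥ* A) s = k).card
    using Nat.strong_induction_on generalizing y with
  | _ n ih =>
    set N := Finset.univ.filter fun s => ¬ ∃ k : ℤ, (y ᵥ* A) s = k with hN
    have hmemN : ∀ s, s ∈ N ↔ ¬ ∃ k : ℤ, (y ᵥ* A) s = k := by simp [hN]
    obtain ⟨y', hy'int, hy', hy'z, hy'T⟩ := h.exists_int_tight_combination hz Nᶜ
      (fun s => ⌊(y ᵥ* A) s⌋) hy hyz (by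
        intro s hs
        rw [Finset.mem_compl, hmemN, not_not] at hs
        obtain ⟨k, hk⟩ := hs
        rw [hk, Int.floor_intCast])
    choose Y hY using hy'int
    have hYQ : ∀ s, (y' ᵥ* A) s = ((Y ᵥ* Q) s : ℤ) := by
      intro s
      simp [Matrix.vecMul, dotProduct, hY, hA]
    have heq : ∀ s ∉ N, (y' ᵥ* A) s = (y ᵥ* A) s := by
      intro s hs
      rw [hy'T s (Finset.mem_compl.2 hs)]
      rw [hmemN, not_not] at hs
      obtain ⟨k, hk⟩ := hs
      rw [hk, Int.floor_intCast]
    rcases N.eq_empty_or_nonempty with hNe | ⟨s₀, hs₀⟩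
    · refine ⟨Y, fun i => ?_, ?_, fun s => ?_⟩
      · have := hy' i
        rw [hY, Pi.zero_apply] at this
        exact Int.cast_nonneg_iff.1 this
      · rw [← hy'z]
        exact congrArg (· ⬝ᵥ _) (funext fun i => (hY i).symm)
      · have e := heq s (by simp [hNe])
        have h1 := hlo s
        have h2 := hhi s
        rw [← e, hYQ] at h1 h2
        exact ⟨by exact_mod_cast h1, by exact_mod_cast h2⟩
    · obtain ⟨t, ht0, ht1, hbox, s₁, hs₁, k, hk⟩ := exists_int_crossing hlo hhi
        (fun s => ⟨_, hYQ s⟩) hs₀ hmemN heq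
      have hcomb : ∀ s, ((y + t • (y' - y)) ᵥ* A) s
          = (y ᵥ* A) s + t * ((y' ᵥ* A) s - (y ᵥ* A) s) := by
        intro s
        rw [Matrix.add_vecMul, Matrix.smul_vecMul, Matrix.sub_vecMul]
        rfl
      refine ih _ ?_ (y := y + t • (y' - y)) ?_ ?_ ?_ ?_ rfl
      · rw [← hn]
        refine Finset.card_lt_card ⟨fun s hs => ?_, fun hsub => ?_⟩
        · by_contra hsN
          rw [Finset.mem_filter, hcomb, heq s hsN, sub_self, mul_zero, add_zero] at hs
          exact hsN ((hmemN s).2 hs.2)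
        · have := hsub hs₁
          rw [Finset.mem_filter, hcomb] at this
          exact this.2 ⟨k, hk⟩
      · intro i
        have h1 := mul_nonneg (sub_nonneg.2 ht1) (hy i)
        have h2 := mul_nonneg ht0 (hy' i)
        simp only [Pi.zero_apply, Pi.add_apply, Pi.smul_apply, Pi.sub_apply, smul_eq_mul] at *
        linarith
      · rw [add_dotProduct, smul_dotProduct, sub_dotProduct, hyz, hy'z]
        simp
      · intro s; rw [hcomb]; exact (hbox s).1
      · intro s; rw [hcomb]; exact (hbox s).2

/-- Farkas alternative for the existence of `y ≥ 0` with `y r ≤ 0`, `y A ≤ u` on `U` and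
`ℓ ≤ y A` on `L`. -/
theorem exists_bounded_combination_or {ι κ : Type*} [Fintype ι] [Fintype κ]
    [DecidableEq κ] (A : Matrix ι κ ℚ) (r : ι → ℚ) (U L : Finset κ) (u ℓ : κ → ℚ) :
    (∃ y : ι → ℚ, 0 ≤ y ∧ y ⬝ᵥ r ≤ 0 ∧ (∀ s ∈ U, (y ᵥ* A) s ≤ u s) ∧
      ∀ s ∈ L, ℓ s ≤ (y ᵥ* A) s) ∨
    ∃ (k : ℚ) (a b : κ → ℚ), 0 ≤ k ∧ 0 ≤ a ∧ 0 ≤ b ∧ (∀ s ∉ U, a s = 0) ∧ (∀ s ∉ L, b s = 0) ∧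
      0 ≤ A *ᵥ (a - b) + k • r ∧ u ⬝ᵥ a < ℓ ⬝ᵥ b := by
  classical
  rw [or_iff_not_imp_left]
  intro hno
  obtain ⟨v, hv, hvA, hvb⟩ := exists_infeasibility_certificate
    (Matrix.fromRows (1 : Matrix ι ι ℚ) (Matrix.fromRows (Matrix.of fun (_ : Unit) i => -r i)
      (Matrix.fromRows (Matrix.of fun (s : κ) i => if s ∈ U then -A i s else 0)
        (Matrix.of fun (s : κ) i => if s ∈ L then A i s else 0))))
    (Sum.elim 0 (Sum.elim 0 (Sum.elim (fun s => if s ∈ U then -u s else 0)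
      fun s => if s ∈ L then ℓ s else 0))) (by
      rintro ⟨y, hy⟩
      refine hno ⟨y, fun i => ?_, ?_, fun s hs => ?_, fun s hs => ?_⟩
      · simpa [Matrix.fromRows_mulVec] using hy (Sum.inl i)
      · have := hy (Sum.inr (Sum.inl ()))
        simp [Matrix.mulVec, dotProduct] at this
        simpa [dotProduct, mul_comm] using this
      · have := hy (Sum.inr (Sum.inr (Sum.inl s)))
        simp [Matrix.mulVec, dotProduct, hs] at this
        simpa [Matrix.vecMul, dotProduct, mul_comm] using this
      · have := hy (Sum.inr (Sum.inr (Sum.inr s)))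
        simp [Matrix.mulVec, dotProduct, hs] at this
        simpa [Matrix.vecMul, dotProduct, mul_comm] using this)
  refine ⟨v (Sum.inr (Sum.inl ())),
    fun s => if s ∈ U then v (Sum.inr (Sum.inr (Sum.inl s))) else 0,
    fun s => if s ∈ L then v (Sum.inr (Sum.inr (Sum.inr s))) else 0, hv _, fun s => ?_,
    fun s => ?_, fun s hs => if_neg hs, fun s hs => if_neg hs, fun i => ?_, ?_⟩
  · dsimp only; split_ifs; exacts [hv _, le_rfl]
  · dsimp only; split_ifs; exacts [hv _, le_rfl]
  · have h0 := hv (Sum.inl i)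
    have := congrFun hvA i
    simp [Matrix.vecMul, dotProduct, Fintype.sum_sum_type, Matrix.one_apply] at this
    have hmul : ∀ (T : Finset κ) (q : κ → ℚ),
        (A *ᵥ fun s => if s ∈ T then q s else 0) i = ∑ s ∈ T, q s * A i s := by
      intro T q
      simp [Matrix.mulVec, dotProduct, mul_comm]
    simp only [Matrix.mulVec_sub, Pi.zero_apply, Pi.add_apply, Pi.sub_apply, Pi.smul_apply,
      smul_eq_mul, hmul] at h0 ⊢
    linarith
  · simp [dotProduct, Fintype.sum_sum_type] at hvb
    simp only [dotProduct, mul_ite, mul_zero, Finset.sum_ite_mem, Finset.univ_inter]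
    simp only [mul_comm (u _), mul_comm (ℓ _)]
    linarith

/-- If the exchange condition holds for all unit moves inside the polyhedron, then a fractional
dual certificate exists. -/
theorem IsBoxTDI.exists_tight_combination_of_forall {ι κ : Type} [Fintype ι] [Fintype κ]
    [DecidableEq κ] {A : Matrix ι κ ℚ} {b : ι → ℚ} (h : IsBoxTDI A b)
    (hb : ∀ i, ∃ k : ℤ, b i = k) {z : κ → ℤ} (hz : b ≤ A *ᵥ fun s => (z s : ℚ))
    {U L : Finset κ} {u ℓ : κ → ℤ} (hlu : ∀ s ∈ L, s ∈ U → ℓ s ≤ u s)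
    (hcond : ∀ Sneg ⊆ L, ∀ Spos ⊆ U, Disjoint Sneg Spos →
      (b ≤ A *ᵥ fun s =>
        ((z s + (if s ∈ Spos then 1 else 0) - (if s ∈ Sneg then 1 else 0) : ℤ) : ℚ)) →
      ∑ s ∈ Sneg, ℓ s ≤ ∑ s ∈ Spos, u s) :
    ∃ y : ι → ℚ, 0 ≤ y ∧ y ⬝ᵥ (A *ᵥ (fun s => (z s : ℚ)) - b) = 0 ∧
      (∀ s ∈ U, (y ᵥ* A) s ≤ u s) ∧ ∀ s ∈ L, ℓ s ≤ (y ᵥ* A) s := by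
  set zq : κ → ℚ := fun s => (z s : ℚ) with hzq
  rcases exists_bounded_combination_or A (A *ᵥ zq - b) U L (fun s => (u s : ℚ))
    (fun s => (ℓ s : ℚ)) with ⟨y, hy, hyr, hyU, hyL⟩ | ⟨k, a, e, hk, ha, he, haU, heL, hA, hlt⟩
  · exact ⟨y, hy, hyr.antisymm (dotProduct_nonneg_of_nonneg hy (sub_nonneg.2 hz)), hyU, hyL⟩
  exfalso
  set d : κ → ℚ := a - e with hd
  have hdU : ∀ s, 0 < d s → s ∈ U := by
    intro s hs
    by_contra hsU
    have := he s
    simp only [hd, Pi.sub_apply, haU s hsU, Pi.zero_apply] at hs this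
    linarith
  have hdL : ∀ s, d s < 0 → s ∈ L := by
    intro s hs
    by_contra hsL
    have := ha s
    simp only [hd, Pi.sub_apply, heL s hsL, Pi.zero_apply] at hs this
    linarith
  set c : κ → ℤ := fun s => if 0 < d s then u s else if d s < 0 then ℓ s else 0 with hc
  have hcd : (fun s => (c s : ℚ)) ⬝ᵥ d < 0 := by
    suffices (fun s => (c s : ℚ)) ⬝ᵥ d ≤ (fun s => (u s : ℚ)) ⬝ᵥ a - (fun s => (ℓ s : ℚ)) ⬝ᵥ e by
      linarith
    simp only [dotProduct]
    rw [← Finset.sum_sub_distrib]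
    refine Finset.sum_le_sum fun s _ => ?_
    have hds : d s = a s - e s := rfl
    have has := ha s
    have hes := he s
    simp only [Pi.zero_apply] at has hes
    have key : ∀ q : ℚ, 0 ≤ q → (s ∉ U → q = 0) → (s ∉ L → q = 0) →
        0 ≤ ((u s : ℚ) - ℓ s) * q := by
      intro q hq h1 h2
      by_cases hsU : s ∈ U
      · by_cases hsL : s ∈ L
        · exact mul_nonneg (sub_nonneg.2 (by exact_mod_cast hlu s hsL hsU)) hq
        · simp [h2 hsL]
      · simp [h1 hsU]
    simp only [hc]
    split_ifs with h1 h2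
    · have := key (e s) hes (fun hs => absurd (hdU s h1) hs) (heL s)
      rw [hds]
      linarith
    · have := key (a s) has (haU s) (fun hs => absurd (hdL s h2) hs)
      rw [hds]
      linarith
    · have hae : e s = a s := by linarith [not_lt.1 h1, not_lt.1 h2]
      have := key (a s) has (haU s) (fun hs => hae ▸ heL s hs)
      rw [hae]
      push_cast
      linarith
  set K : ℚ := 1 + k + ∑ s, |d s| with hK
  have hdK : ∀ s, |d s| ≤ K := by
    intro s
    have := Finset.single_le_sum (f := fun s => |d s|) (fun i _ => abs_nonneg _) (Finset.mem_univ s)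
    linarith
  have hsum : 0 ≤ ∑ s, |d s| := Finset.sum_nonneg fun i _ => abs_nonneg _
  have hK0 : 0 < K := by linarith
  have hkK : K⁻¹ * k ≤ 1 := by
    rw [inv_mul_le_iff₀ hK0]
    linarith
  have hKd : ∀ s, |K⁻¹ * d s| ≤ 1 := by
    intro s
    rw [abs_mul, abs_of_pos (inv_pos.2 hK0), inv_mul_le_iff₀ hK0, mul_one]
    exact hdK s
  set f : κ → ℚ := fun s => ((if d s < 0 then z s - 1 else z s : ℤ) : ℚ) with hf
  set g : κ → ℚ := fun s => ((if 0 < d s then z s + 1 else z s : ℤ) : ℚ) with hg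
  have hx₀ : b ≤ A *ᵥ (zq + K⁻¹ • d) ∧ f ≤ zq + K⁻¹ • d ∧ zq + K⁻¹ • d ≤ g := by
    refine ⟨fun i => ?_, fun s => ?_, fun s => ?_⟩
    · have h1 := hA i
      have h2 := hz i
      have h3 := mul_nonneg (inv_nonneg.2 hK0.le) h1
      have h4 := mul_nonneg (sub_nonneg.2 hkK) (sub_nonneg.2 h2)
      rw [Matrix.mulVec_add, Matrix.mulVec_smul]
      simp only [Pi.add_apply, Pi.smul_apply, Pi.sub_apply, smul_eq_mul] at h3 h4 ⊢
      linarith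
    · have h1 := (abs_le.1 (hKd s)).1
      simp only [hf, Pi.add_apply, Pi.smul_apply, smul_eq_mul, hzq]
      split_ifs with h0
      · push_cast; linarith
      · have := mul_nonneg (inv_nonneg.2 hK0.le) (not_lt.1 h0)
        linarith
    · have h1 := (abs_le.1 (hKd s)).2
      simp only [hg, Pi.add_apply, Pi.smul_apply, smul_eq_mul, hzq]
      split_ifs with h0
      · push_cast; linarith
      · have := mul_nonpos_of_nonneg_of_nonpos (inv_nonneg.2 hK0.le) (not_lt.1 h0)
        linarith
  obtain ⟨x, ⟨hxR, hfx, hxg⟩, hxint, hxc⟩ := h.exists_int_dotProduct_le hb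
    (fun s => ⟨_, rfl⟩) (fun s => ⟨_, rfl⟩) c hx₀
  choose X hX using hxint
  have hXeq : x = fun s => (X s : ℚ) := funext hX
  have hfX : ∀ s, (if d s < 0 then z s - 1 else z s) ≤ X s := by
    intro s
    have := hfx s
    rw [hX] at this
    exact Int.cast_le.1 this
  have hXg : ∀ s, X s ≤ (if 0 < d s then z s + 1 else z s) := by
    intro s
    have := hxg s
    rw [hX] at this
    exact Int.cast_le.1 this
  have hcX : ∑ s, c s * (X s - z s) < 0 := by
    rw [dotProduct_add, dotProduct_smul, smul_eq_mul] at hxc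
    have h1 := mul_neg_of_pos_of_neg (inv_pos.2 hK0) hcd
    have : (fun s => (c s : ℚ)) ⬝ᵥ x - (fun s => (c s : ℚ)) ⬝ᵥ zq < 0 := by linarith
    rw [← dotProduct_sub, hXeq] at this
    simp only [dotProduct, Pi.sub_apply, hzq] at this
    exact_mod_cast this
  set P := Finset.univ.filter fun s => z s < X s with hP
  set N := Finset.univ.filter fun s => X s < z s with hN
  have hPd : ∀ s, z s < X s → 0 < d s ∧ X s = z s + 1 := by
    intro s hs
    have := hXg s
    split_ifs at this with h0
    · exact ⟨h0, by omega⟩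
    · omega
  have hNd : ∀ s, X s < z s → d s < 0 ∧ X s = z s - 1 := by
    intro s hs
    have := hfX s
    split_ifs at this with h0
    · exact ⟨h0, by omega⟩
    · omega
  have hXz : ∀ s, X s = z s + (if s ∈ P then 1 else 0) - (if s ∈ N then 1 else 0) := by
    intro s
    simp only [hP, hN, Finset.mem_filter, Finset.mem_univ, true_and]
    rcases lt_trichotomy (X s) (z s) with hs | hs | hs
    · rw [if_neg (by omega), if_pos hs, (hNd s hs).2]; ring
    · rw [if_neg (by omega), if_neg (by omega), hs]; ring
    · rw [if_pos hs, if_neg (by omega), (hPd s hs).2]; ring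
  have hle := hcond N (fun s hs => hdL s (hNd s (by simpa [hN] using hs)).1)
    P (fun s hs => hdU s (hPd s (by simpa [hP] using hs)).1)
    (Finset.disjoint_left.2 fun s hs hs' => by
      simp only [hP, hN, Finset.mem_filter] at hs hs'
      exact absurd hs.2 (not_lt.2 hs'.2.le))
    (by simp only [← hXz]; rwa [← hXeq])
  have hval : ∑ s, c s * (X s - z s) = ∑ s ∈ P, u s - ∑ s ∈ N, ℓ s := by
    rw [hP, hN, Finset.sum_filter, Finset.sum_filter, ← Finset.sum_sub_distrib]
    refine Finset.sum_congr rfl fun s _ => ?_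
    rcases lt_trichotomy (X s) (z s) with hs | hs | hs
    · obtain ⟨h1, h2⟩ := hNd s hs
      rw [if_neg (by omega), if_pos hs, h2]
      simp only [hc, if_neg (not_lt.2 h1.le), if_pos h1]
      ring
    · rw [if_neg (by omega), if_neg (by omega), hs]; ring
    · obtain ⟨h1, h2⟩ := hPd s hs
      rw [if_pos hs, if_neg (by omega), h2]
      simp only [hc, if_pos h1]
      ring
  linarith

theorem EReal.coe_int_sum {κ : Type*} (s : Finset κ) (f : κ → ℤ) :
    (((∑ i ∈ s, f i : ℤ) : ℝ) : EReal) = ∑ i ∈ s, ((f i : ℝ) : EReal) := by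
  classical
  induction s using Finset.induction_on with
  | empty => simp
  | insert i s hi ih =>
    rw [Finset.sum_insert hi, Finset.sum_insert hi, ← ih]
    push_cast
    rfl

/-- **the main tool.** Let `Q x ≥ p` be a box-TDI system with integral data,
`R = {x : Q x ≥ p}`, `z*` an integral element of `R`, and `ℓ ≤ u` integer-valued bounding
vectors possibly taking the values `-∞` resp. `+∞` (encoded in the extended reals).
There is an integral vector `y* ≥ 0` with `ℓ ≤ y* Q ≤ u` and `y* (Q z* - p) = 0` iff
`ℓ̃(S⁻) ≤ ũ(S⁺)` for every pair of disjoint subsets `(S⁻, S⁺)` of `S` with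
`z* + χ_{S⁺} - χ_{S⁻} ∈ R`. -/
theorem exists_dual_certificate_iff {m : ℕ} {S : Type} [Fintype S] [DecidableEq S]
    (Q : Matrix (Fin m) S ℤ) (p : Fin m → ℤ)
    (hbox : IsBoxTDI (Q.map (Int.cast : ℤ → ℚ)) fun i => (p i : ℚ))
    (zstar : S → ℤ)
    (hz : (fun i => (p i : ℚ)) ≤ (Q.map (Int.cast : ℤ → ℚ)) *ᵥ fun s => (zstar s : ℚ))
    (ℓ u : S → EReal)
    (hℓ : ∀ s, ℓ s = ⊥ ∨ ∃ k : ℤ, ℓ s = ((k : ℝ) : EReal))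
    (hu : ∀ s, u s = ⊤ ∨ ∃ k : ℤ, u s = ((k : ℝ) : EReal))
    (hlu : ℓ ≤ u) :
    (∃ y : Fin m → ℤ, 0 ≤ y ∧
        (∀ s, ℓ s ≤ (((y ᵥ* Q) s : ℝ) : EReal) ∧ (((y ᵥ* Q) s : ℝ) : EReal) ≤ u s) ∧
        y ⬝ᵥ (Q *ᵥ zstar - p) = 0) ↔
      ∀ Sneg Spos : Finset S, Disjoint Sneg Spos →
        ((fun i => (p i : ℚ)) ≤ (Q.map (Int.cast : ℤ → ℚ)) *ᵥ fun s =>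
          ((zstar s + (if s ∈ Spos then 1 else 0) - (if s ∈ Sneg then 1 else 0) : ℤ) : ℚ)) →
        ∑ s ∈ Sneg, ℓ s ≤ ∑ s ∈ Spos, u s := by
  have hslack : ∀ y : Fin m → ℤ, (fun i => (y i : ℚ)) ⬝ᵥ ((Q.map (Int.cast : ℤ → ℚ)) *ᵥ
      (fun s => (zstar s : ℚ)) - fun i => (p i : ℚ)) = ((y ⬝ᵥ (Q *ᵥ zstar - p) : ℤ) : ℚ) := by
    intro y
    simp [dotProduct, Matrix.mulVec]
  constructor
  · rintro ⟨y, hy, hyb, hyz⟩ Sneg Spos - hR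
    set d : S → ℤ := fun s => (if s ∈ Spos then 1 else 0) - (if s ∈ Sneg then 1 else 0) with hd
    have hR' : p ≤ Q *ᵥ (zstar + d) := by
      intro i
      have := hR i
      simp only [Matrix.mulVec, dotProduct, Matrix.map_apply] at this
      simp only [Matrix.mulVec, dotProduct, hd, Pi.add_apply, ← add_sub_assoc]
      exact_mod_cast this
    have h1 : 0 ≤ y ⬝ᵥ (Q *ᵥ (zstar + d) - p) :=
      dotProduct_nonneg_of_nonneg hy (sub_nonneg.2 hR')
    have h2 : y ⬝ᵥ (Q *ᵥ (zstar + d) - p) = (y ᵥ* Q) ⬝ᵥ d := by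
      rw [Matrix.mulVec_add, add_sub_right_comm, dotProduct_add, hyz, zero_add,
        Matrix.dotProduct_mulVec]
    have h3 : (y ᵥ* Q) ⬝ᵥ d = ∑ s ∈ Spos, (y ᵥ* Q) s - ∑ s ∈ Sneg, (y ᵥ* Q) s := by
      simp [dotProduct, hd, mul_sub, Finset.sum_sub_distrib]
    have h4 : ∑ s ∈ Sneg, (y ᵥ* Q) s ≤ ∑ s ∈ Spos, (y ᵥ* Q) s := by linarith
    calc ∑ s ∈ Sneg, ℓ s ≤ ∑ s ∈ Sneg, (((y ᵥ* Q) s : ℝ) : EReal) :=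
          Finset.sum_le_sum fun s _ => (hyb s).1
      _ = (((∑ s ∈ Sneg, (y ᵥ* Q) s : ℤ) : ℝ) : EReal) := (EReal.coe_int_sum _ _).symm
      _ ≤ (((∑ s ∈ Spos, (y ᵥ* Q) s : ℤ) : ℝ) : EReal) := by exact_mod_cast h4
      _ = ∑ s ∈ Spos, (((y ᵥ* Q) s : ℝ) : EReal) := EReal.coe_int_sum _ _
      _ ≤ ∑ s ∈ Spos, u s := Finset.sum_le_sum fun s _ => (hyb s).2
  · intro hcond
    classical
    have hℓ' : ∀ s, ∃ k : ℤ, ℓ s ≠ ⊥ → ℓ s = ((k : ℝ) : EReal) := fun s =>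
      (hℓ s).elim (fun h => ⟨0, fun h' => absurd h h'⟩) fun ⟨k, hk⟩ => ⟨k, fun _ => hk⟩
    have hu' : ∀ s, ∃ k : ℤ, u s ≠ ⊤ → u s = ((k : ℝ) : EReal) := fun s =>
      (hu s).elim (fun h => ⟨0, fun h' => absurd h h'⟩) fun ⟨k, hk⟩ => ⟨k, fun _ => hk⟩
    choose lz hlz using hℓ'
    choose uz huz using hu'
    set L := Finset.univ.filter fun s => ℓ s ≠ ⊥ with hL
    set U := Finset.univ.filter fun s => u s ≠ ⊤ with hU
    have hlL : ∀ s ∈ L, ℓ s = ((lz s : ℝ) : EReal) := fun s hs => hlz s (by simpa [hL] using hs)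
    have huU : ∀ s ∈ U, u s = ((uz s : ℝ) : EReal) := fun s hs => huz s (by simpa [hU] using hs)
    have hlb : ∀ s ∉ L, ℓ s = ⊥ := fun s hs => by simpa [hL] using hs
    have hut : ∀ s ∉ U, u s = ⊤ := fun s hs => by simpa [hU] using hs
    obtain ⟨y, hy, hyz, hyU, hyL⟩ := hbox.exists_tight_combination_of_forall
      (fun i => ⟨p i, rfl⟩) hz (U := U) (L := L) (u := uz) (ℓ := lz) (by
        intro s hsL hsU
        have := hlu s
        rw [hlL s hsL, huU s hsU] at this
        exact Int.cast_le.1 (EReal.coe_le_coe_iff.1 this)) (by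
        intro Sneg hneg Spos hpos hdisj hR
        have := hcond Sneg Spos hdisj hR
        rw [Finset.sum_congr rfl fun s hs => hlL s (hneg hs),
          Finset.sum_congr rfl fun s hs => huU s (hpos hs), ← EReal.coe_int_sum,
          ← EReal.coe_int_sum] at this
        exact_mod_cast this)
    set w := y ᵥ* Q.map (Int.cast : ℤ → ℚ) with hw
    obtain ⟨y', hy', hy'z, hy'b⟩ := hbox.exists_int_tight_combination_mem_box hz
      (fun s => if s ∈ L then lz s else ⌊w s⌋) (fun s => if s ∈ U then uz s else ⌈w s⌉) hy hyz
      (fun s => by split_ifs with hs; exacts [hyL s hs, Int.floor_le _])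
      (fun s => by split_ifs with hs; exacts [hyU s hs, Int.le_ceil _])
    refine ⟨y', hy', fun s => ⟨?_, ?_⟩, ?_⟩
    · by_cases hs : s ∈ L
      · have := (hy'b s).1
        rw [if_pos hs] at this
        rw [hlL s hs]
        exact_mod_cast this
      · rw [hlb s hs]
        exact bot_le
    · by_cases hs : s ∈ U
      · have := (hy'b s).2
        rw [if_pos hs] at this
        rw [huU s hs]
        exact_mod_cast this
      · rw [hut s hs]
        exact le_top
    · rw [hslack] at hy'z
      exact_mod_cast hy'z
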